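/- arXiv:2512.07238 — 8 statements merged into one kernel-verified Lean document; each statement's English description precedes it below -/
import Mathlib

section
/- Let G be a finitely generated residually finite group and let φ : G → G be a group endomorphism whose image φ(G) has finite index in G. Then there exists a natural number n such that the restriction of φ to the subgroup φ^n(G) (the image of the n-fold iterate of φ) is injective. -/
def ResiduallyFinite (G : Type*) [Group G] : Prop :=
  ∀ g : G, g ≠ 1 → ∃ (Q : Type) (_ : Group Q) (_ : Finite Q) (ρ : G →* Q), ρ g ≠ 1

/-- There are only finitely many homomorphisms from a finitely generated group to a finite one. -/
theorem finite_monoidHom_of_fg {G Q : Type*} [Group G] [Group.FG G] [Group Q] [Finite Q] :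
    Finite (G →* Q) := by
  obtain ⟨S, hS⟩ := (Group.fg_def (G := G)).1 inferInstance
  refine Finite.of_injective (fun (f : G →* Q) (s : S) => f s) fun f g h => ?_
  exact MonoidHom.eq_of_eqOn_dense hS fun s hs => congrFun h ⟨s, hs⟩

/-- The index of `A` in `B` can only drop under a homomorphism. -/
theorem Subgroup.relIndex_map_map_dvd {G G' : Type*} [Group G] [Group G'] (f : G →* G')
    (A B : Subgroup G) :
    (A.map f).relIndex (B.map f) ∣ A.relIndex B := by
  rw [← Subgroup.relIndex_comap]
  exact Subgroup.relIndex_dvd_of_le_left B (Subgroup.le_comap_map f A)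

/-- If the finite index of `A` in `B` is preserved by `f`, then `A` contains `ker f ⊓ B`. -/
theorem Subgroup.ker_inf_le_of_relIndex_map_map_eq {G G' : Type*} [Group G] [Group G']
    (f : G →* G') {A B : Subgroup G} (hAB : A ≤ B) (h0 : A.relIndex B ≠ 0)
    (h : (A.map f).relIndex (B.map f) = A.relIndex B) : f.ker ⊓ B ≤ A := by
  rw [← Subgroup.relIndex_comap, ← Subgroup.inf_relIndex_right] at h
  have hmul := Subgroup.relIndex_mul_relIndex A ((A.map f).comap f ⊓ B) B
    (le_inf (Subgroup.le_comap_map f A) hAB) inf_le_right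
  rw [h] at hmul
  have h1 := Subgroup.relIndex_eq_one.1 (mul_eq_right₀ h0 |>.1 hmul)
  refine le_trans (inf_le_inf_right B fun x hx => ?_) h1
  rw [Subgroup.mem_comap, MonoidHom.mem_ker.1 hx]
  exact one_mem _

/-- In a finitely generated residually finite group, the kernel of an endomorphism `φ` meets
the intersection of the images of the iterates of `φ` trivially. -/
theorem ResiduallyFinite.eq_one_of_forall_mem_range_iterate {G : Type*} [Group G] [Group.FG G]
    (hRF : ResiduallyFinite G) (φ : G →* G) {k : G} (hk : φ k = 1)
    (hmem : ∀ n : ℕ, k ∈ Set.range (⇑φ)^[n]) : k = 1 := by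
  by_contra hne
  obtain ⟨Q, _, _, ρ, hρ⟩ := hRF k hne
  have := finite_monoidHom_of_fg (G := G) (Q := Q)
  let ψ : Monoid.End G := φ
  obtain ⟨m, n, hmn, h⟩ : ∃ m n : ℕ, m < n ∧
      ρ.comp (ψ ^ m) = ρ.comp (ψ ^ n) := by
    obtain ⟨m, n, hmn, h⟩ := Finite.exists_ne_map_eq_of_infinite
      fun n : ℕ => ρ.comp (ψ ^ n)
    rcases hmn.lt_or_gt with hlt | hlt
    exacts [⟨m, n, hlt, h⟩, ⟨n, m, hlt, h.symm⟩]
  obtain ⟨x, hx⟩ := hmem m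
  have hρx : ρ (φ^[m] x) = ρ (φ^[n] x) := by
    have hψ (j : ℕ) : (ψ ^ j) x = φ^[j] x := congrFun (Monoid.End.coe_pow G ψ j) x
    rw [← hψ, ← hψ]
    exact DFunLike.congr_fun h x
  apply hρ
  obtain ⟨d, rfl⟩ := Nat.exists_eq_add_of_lt hmn
  rw [← hx, hρx, show m + d + 1 = d + 1 + m by omega, Function.iterate_add_apply, hx,
    Function.iterate_succ_apply, hk, iterate_map_one, map_one]

/-- The images of the iterates of an endomorphism. -/
theorem Subgroup.coe_iterate_map_top {G : Type*} [Group G] (φ : G →* G) (n : ℕ) :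
    (((Subgroup.map φ)^[n] ⊤ : Subgroup G) : Set G) = Set.range (⇑φ)^[n] := by
  induction n with
  | zero => simp
  | succ n ih =>
    rw [Function.iterate_succ_apply', Subgroup.coe_map, ih, Function.iterate_succ',
      Set.range_comp]

/-- Hirshon: if `φ` is an endomorphism of a finitely generated residually finite group `G`
with image of finite index in `G`, then `φ` is injective on `φ^n(G)` for some `n`. -/
theorem exists_injOn_iterate_image {G : Type*} [Group G] [Group.FG G]
    (hRF : ResiduallyFinite G) (φ : G →* G) (hfi : φ.range.FiniteIndex) :
    ∃ n : ℕ, Set.InjOn ⇑φ (Set.range (⇑φ)^[n]) := by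
  let H : ℕ → Subgroup G := fun n => (Subgroup.map φ)^[n] ⊤
  have hH (n : ℕ) : H (n + 1) = (H n).map φ := Function.iterate_succ_apply' _ _ _
  have hle (n : ℕ) : H (n + 1) ≤ H n := by
    induction n with
    | zero => exact le_top
    | succ n ih => exact hH (n + 1) ▸ (Subgroup.map_mono ih).trans_eq (hH n).symm
  have hanti : Antitone H := antitone_nat_of_succ_le hle
  let d : ℕ → ℕ := fun n => (H (n + 1)).relIndex (H n)
  have hd (n : ℕ) : d (n + 1) = ((H (n + 1)).map φ).relIndex ((H n).map φ) := by
    simp only [d, hH]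
  have hdvd (n : ℕ) : d (n + 1) ∣ d n :=
    hd n ▸ Subgroup.relIndex_map_map_dvd φ _ _
  have hd0 (n : ℕ) : d n ≠ 0 := by
    induction n with
    | zero => simpa [d, H, ← MonoidHom.range_eq_map] using hfi.index_ne_zero
    | succ n ih => exact ne_zero_of_dvd_ne_zero ih (hdvd n)
  have hdanti : Antitone d :=
    antitone_nat_of_succ_le fun n => Nat.le_of_dvd (Nat.pos_of_ne_zero (hd0 n)) (hdvd n)
  obtain ⟨N, hN⟩ : ∃ N, ∀ n, N ≤ n → d N = d n :=
    ⟨Function.argmin d, fun n hn => le_antisymm (Function.argmin_le d n) (hdanti hn)⟩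
  refine ⟨N, ?_⟩
  rw [← Subgroup.coe_iterate_map_top]
  intro x hx y hy hxy
  have hker : φ (x * y⁻¹) = 1 := by simp [hxy]
  have hmem (n : ℕ) (hn : N ≤ n) : x * y⁻¹ ∈ H n := by
    induction n, hn using Nat.le_induction with
    | base => exact mul_mem hx (inv_mem hy)
    | succ n hn ih =>
      refine Subgroup.ker_inf_le_of_relIndex_map_map_eq φ (hle n) (hd0 n) ?_ ⟨hker, ih⟩
      exact (hd n).symm.trans ((hN (n + 1) (by omega)).symm.trans (hN n hn))
  refine mul_inv_eq_one.1 (hRF.eq_one_of_forall_mem_range_iterate φ hker fun n => ?_)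
  rw [← Subgroup.coe_iterate_map_top]
  exact hanti (le_max_left n N) (hmem _ (le_max_right n N))
end

section
/- Let G be a finitely generated residually finite group and let φ : G → G be a group endomorphism whose image φ(G) has finite index in G. Then the kernel of φ is a finite subgroup of G. -/
theorem MonoidHom.finite_of_fg (G Q : Type*) [Group G] [Group.FG G] [Group Q] [Finite Q] :
    Finite (G →* Q) := by
  obtain ⟨S, hS⟩ := Group.FG.out (G := G)
  refine Finite.of_injective (fun (f : G →* Q) (s : S) => f s) fun f g h => ?_
  exact MonoidHom.eq_of_eqOn_dense hS fun s hs => congrFun h ⟨s, hs⟩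

theorem MonoidHom.card_ker_eq_index_range {G : Type*} [Group G] [Finite G] (ψ : G →* G) :
    Nat.card ψ.ker = ψ.range.index := by
  have h₁ := ψ.ker.card_mul_index
  have h₂ := ψ.range.card_mul_index
  rw [Subgroup.index_ker, ← h₂, mul_comm] at h₁
  exact Nat.eq_of_mul_eq_mul_left Nat.card_pos h₁

/-- An injective family indexed by a finite type stays injective under some homomorphism
to a finite group. -/
theorem ResiduallyFinite.exists_hom_injective_comp {G : Type*} [Group G]
    (hRF : ResiduallyFinite G) {n : ℕ} (x : Fin n → G) (hx : Function.Injective x) :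
    ∃ (Q : Type) (_ : Group Q) (_ : Finite Q) (ρ : G →* Q),
      Function.Injective fun i => ρ (x i) := by
  have key (p : Fin n × Fin n) : ∃ (Q : Type) (_ : Group Q) (_ : Finite Q) (ρ : G →* Q),
      ρ (x p.1) = ρ (x p.2) → p.1 = p.2 := by
    by_cases h : p.1 = p.2
    · exact ⟨Unit, inferInstance, inferInstance, 1, fun _ => h⟩
    · have hne : x p.1 * (x p.2)⁻¹ ≠ 1 := fun h' => h (hx (mul_inv_eq_one.mp h'))
      obtain ⟨Q, _, _, ρ, hρ⟩ := hRF _ hne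
      exact ⟨Q, inferInstance, inferInstance, ρ, fun h' => absurd (by simp [h']) hρ⟩
  choose Q hQ hQfin ρ hρ using key
  exact ⟨∀ p, Q p, inferInstance, inferInstance, MonoidHom.pi ρ, fun i j hij =>
    hρ (i, j) (congrFun hij (i, j))⟩

/-- An endomorphism of a finitely generated group preserves the intersection of the kernels of
all homomorphisms to a fixed finite group; the induced endomorphism of the finite quotient has
kernel of order at most the index of the image. -/
theorem MonoidHom.le_index_range_of_injective_comp {G Q : Type*} [Group G] [Group.FG G]
    [Group Q] [Finite Q] (φ : G →* G) (hfi : φ.range.FiniteIndex) {n : ℕ} (x : Fin n → φ.ker)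
    (ρ : G →* Q) (hρ : Function.Injective fun i => ρ (x i)) : n ≤ φ.range.index := by
  have := MonoidHom.finite_of_fg G Q
  let N : Subgroup G := (MonoidHom.pi fun f : G →* Q => f).ker
  have mem_N (g : G) : g ∈ N ↔ ∀ f : G →* Q, f g = 1 := by
    rw [MonoidHom.mem_ker, funext_iff]
    rfl
  have : N.FiniteIndex := inferInstance
  have hN : N ≤ N.comap φ := fun g hg => by
    rw [Subgroup.mem_comap, mem_N]
    exact fun f => (mem_N g).mp hg (f.comp φ)
  let ψ := QuotientGroup.map N N φ hN
  have hrange : ψ.range = φ.range.map (QuotientGroup.mk' N) := by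
    ext y
    constructor
    · rintro ⟨⟨g⟩, rfl⟩
      exact ⟨φ g, ⟨g, rfl⟩, rfl⟩
    · rintro ⟨_, ⟨g, rfl⟩, rfl⟩
      exact ⟨g, rfl⟩
  have hdvd : ψ.range.index ∣ φ.range.index := by
    rw [hrange]
    exact Subgroup.index_map_dvd _ (QuotientGroup.mk'_surjective N)
  let y (i : Fin n) : ψ.ker := ⟨((x i : G) : G ⧸ N), by
    rw [MonoidHom.mem_ker, QuotientGroup.map_mk, (x i).2, QuotientGroup.mk_one]⟩
  have hy : Function.Injective y := fun i j hij => hρ <| by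
    have h := (mem_N _).mp (QuotientGroup.eq.mp (Subtype.ext_iff.mp hij)) ρ
    rw [map_mul, map_inv] at h
    exact inv_mul_eq_one.mp h
  calc n = Nat.card (Fin n) := by simp
    _ ≤ Nat.card ψ.ker := Nat.card_le_card_of_injective y hy
    _ = ψ.range.index := ψ.card_ker_eq_index_range
    _ ≤ φ.range.index := Nat.le_of_dvd (Nat.pos_of_ne_zero hfi.index_ne_zero) hdvd

/-- If `φ` is an endomorphism of a finitely generated residually finite group `G`
with image of finite index in `G`, then the kernel of `φ` is finite. -/
theorem finite_ker_of_finiteIndex_range {G : Type*} [Group G] [Group.FG G]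
    (hRF : ResiduallyFinite G) (φ : G →* G) (hfi : φ.range.FiniteIndex) :
    Finite φ.ker := by
  by_contra h
  have : Infinite φ.ker := not_finite_iff_infinite.mp h
  let x : Fin (φ.range.index + 1) ↪ φ.ker :=
    Fin.valEmbedding.trans (Infinite.natEmbedding φ.ker)
  obtain ⟨Q, _, _, ρ, hρ⟩ := hRF.exists_hom_injective_comp (fun i => (x i : G))
    (Subtype.val_injective.comp x.injective)
  exact Nat.not_succ_le_self _ (φ.le_index_range_of_injective_comp hfi x ρ hρ)
end

section
/- Let A and B be nontrivial finitely generated residually finite groups, let G = A ∗ B be their free product, and let φ : G → G be a group endomorphism whose image φ(G) has finite index in G. Then φ is injective. -/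
open Monoid.Coprod

section ResiduallyFinite

theorem ResiduallyFinite.exists_ne_one_of_finite {G : Type*} [Group G]
    (hG : ResiduallyFinite G) {s : Set G} (hs : s.Finite) :
    ∃ (Q : Type) (_ : Group Q) (_ : Finite Q) (ρ : G →* Q), ∀ g ∈ s, g ≠ 1 → ρ g ≠ 1 := by
  induction s, hs using Set.Finite.induction_on with
  | empty => exact ⟨Unit, inferInstance, inferInstance, 1, by simp⟩
  | @insert a s _ _ ih =>
    obtain ⟨Q, _, _, ρ, hρ⟩ := ih
    by_cases ha : a = 1
    · refine ⟨Q, inferInstance, inferInstance, ρ, fun g hg h1 => ?_⟩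
      rcases hg with rfl | hg
      · exact absurd ha h1
      · exact hρ g hg h1
    · obtain ⟨P, _, _, σ, hσ⟩ := hG a ha
      refine ⟨P × Q, inferInstance, inferInstance, σ.prod ρ, fun g hg h1 h => ?_⟩
      rw [MonoidHom.prod_apply, Prod.mk_eq_one] at h
      rcases hg with rfl | hg
      · exact hσ h.1
      · exact hρ g hg h1 h.2

theorem ResiduallyFinite.of_injective {G H : Type*} [Group G] [Group H] (hH : ResiduallyFinite H)
    (f : G →* H) (hf : Function.Injective f) : ResiduallyFinite G := by
  intro g hg
  obtain ⟨Q, _, _, ρ, hρ⟩ := hH (f g) ((map_ne_one_iff f hf).2 hg)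
  exact ⟨Q, inferInstance, inferInstance, ρ.comp f, hρ⟩

end ResiduallyFinite

namespace Monoid.CoprodI

open Word

variable {ι : Type*}

section Truncated

variable {Q : ι → Type*} [∀ i, Group (Q i)]

/-- Reduced words of length at most `n`. -/
abbrev BoundedWord (Q : ι → Type*) [∀ i, Group (Q i)] (n : ℕ) : Type _ :=
  {w : Word Q // w.toList.length ≤ n}

theorem BoundedWord.finite [Finite ι] [∀ i, Finite (Q i)] (n : ℕ) : Finite (BoundedWord Q n) := by
  have : Finite {l : List (Σ i, Q i) // l.length ≤ n} :=
    (List.finite_length_le (Σ i, Q i) n).to_subtype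
  refine Finite.of_injective
    (fun w : BoundedWord Q n => (⟨w.1.toList, w.2⟩ : {l : List (Σ i, Q i) // l.length ≤ n})) ?_
  intro v w h
  exact Subtype.ext (Word.ext (Subtype.mk.inj h))

variable [DecidableEq ι] [∀ i, DecidableEq (Q i)]

theorem Word.length_smul_le {i : ι} (m : Q i) (w : Word Q) :
    (m • w).toList.length ≤ (equivPair i w).tail.toList.length + 1 := by
  rw [smul_def, rcons]
  split_ifs <;> simp

theorem Word.equivPair_smul_tail {i : ι} (m : Q i) (w : Word Q) :
    (equivPair i (m • w)).tail = (equivPair i w).tail := by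
  rw [smul_eq_of_smul, equivPair_smul_same]

/-- The action of a letter on reduced words of length at most `n`: it agrees with the action on
all words on those orbits of the factor which consist of words of length at most `n`, and is
trivial on the other words. -/
def truncatedSMul (n : ℕ) {i : ι} (m : Q i) (w : BoundedWord Q n) : BoundedWord Q n :=
  if h : (equivPair i w.1).tail.toList.length < n then
    ⟨m • w.1, (Word.length_smul_le m w.1).trans h⟩
  else w

theorem coe_truncatedSMul_of_lt {n : ℕ} {i : ι} (m : Q i) (w : BoundedWord Q n)
    (h : (equivPair i w.1).tail.toList.length < n) :
    (truncatedSMul n m w : Word Q) = m • (w : Word Q) := by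
  rw [truncatedSMul, dif_pos h]

theorem truncatedSMul_of_not_lt {n : ℕ} {i : ι} (m : Q i) (w : BoundedWord Q n)
    (h : ¬ (equivPair i w.1).tail.toList.length < n) : truncatedSMul n m w = w :=
  dif_neg h

/-- The action of a factor on reduced words of length at most `n` given by `truncatedSMul`. -/
abbrev truncatedAction (Q : ι → Type*) [∀ i, Group (Q i)] [∀ i, DecidableEq (Q i)] (n : ℕ)
    (i : ι) : MulAction (Q i) (BoundedWord Q n) where
  smul := truncatedSMul n
  one_smul w := by
    change truncatedSMul n 1 w = w
    by_cases h : (equivPair i w.1).tail.toList.length < n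
    · exact Subtype.ext ((coe_truncatedSMul_of_lt 1 w h).trans (one_smul _ _))
    · exact truncatedSMul_of_not_lt 1 w h
  mul_smul m m' w := by
    change truncatedSMul n (m * m') w = truncatedSMul n m (truncatedSMul n m' w)
    by_cases h : (equivPair i w.1).tail.toList.length < n
    · have h' : (equivPair i (truncatedSMul n m' w).1).tail.toList.length < n := by
        rwa [coe_truncatedSMul_of_lt m' w h, Word.equivPair_smul_tail]
      apply Subtype.ext
      rw [coe_truncatedSMul_of_lt _ _ h, coe_truncatedSMul_of_lt _ _ h',
        coe_truncatedSMul_of_lt _ _ h, mul_smul]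
    · rw [truncatedSMul_of_not_lt _ _ h, truncatedSMul_of_not_lt _ _ h,
        truncatedSMul_of_not_lt _ _ h]

/-- The permutation representation of a free product on reduced words of length at most `n`. -/
def truncatedPermHom (Q : ι → Type*) [∀ i, Group (Q i)] [∀ i, DecidableEq (Q i)] (n : ℕ) :
    CoprodI Q →* Equiv.Perm (BoundedWord Q n) :=
  lift fun i => @MulAction.toPermHom (Q i) (BoundedWord Q n) _ (truncatedAction Q n i)

theorem truncatedPermHom_of (n : ℕ) {i : ι} (m : Q i) (w : BoundedWord Q n) :
    truncatedPermHom Q n (of m) w = truncatedSMul n m w := by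
  rw [truncatedPermHom, lift_of]
  rfl

theorem coe_truncatedPermHom_prod_empty (n : ℕ) (w : Word Q) (hw : w.toList.length ≤ n) :
    (truncatedPermHom Q n w.prod ⟨Word.empty, n.zero_le⟩ : Word Q) = w := by
  induction w using consRecOn with
  | empty => simp
  | cons i m w h1 h2 ih =>
    have hlt : w.toList.length < n := hw
    have e : truncatedPermHom Q n w.prod ⟨Word.empty, n.zero_le⟩ = ⟨w, hlt.le⟩ :=
      Subtype.ext (ih hlt.le)
    rw [prod_cons, map_mul, Equiv.Perm.mul_apply, e, truncatedPermHom_of,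
      coe_truncatedSMul_of_lt, cons_eq_smul, smul_eq_of_smul]
    rwa [equivPair_eq_of_fstIdx_ne h1]

end Truncated

section ResiduallyFinite

variable {G Q : ι → Type*} [∀ i, Group (G i)] [∀ i, Group (Q i)]

/-- The image of a reduced word under homomorphisms of the factors which do not kill its
letters. -/
def Word.mapHom (ρ : ∀ i, G i →* Q i) (w : Word G) (h : ∀ l ∈ w.toList, ρ l.1 l.2 ≠ 1) :
    Word Q where
  toList := w.toList.map fun l => ⟨l.1, ρ l.1 l.2⟩
  ne_one := by
    intro l hl
    obtain ⟨l', hl', rfl⟩ := List.mem_map.1 hl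
    exact h l' hl'
  chain_ne := (List.isChain_map _).2 w.chain_ne

theorem Word.prod_mapHom (ρ : ∀ i, G i →* Q i) (w : Word G)
    (h : ∀ l ∈ w.toList, ρ l.1 l.2 ≠ 1) :
    (w.mapHom ρ h).prod = lift (fun i => of.comp (ρ i)) w.prod := by
  simp [Word.prod, Word.mapHom, map_list_prod, List.map_map, Function.comp_def]

theorem residuallyFinite {ι : Type} [Finite ι] {G : ι → Type*} [∀ i, Group (G i)]
    (hG : ∀ i, ResiduallyFinite (G i)) : ResiduallyFinite (CoprodI G) := by
  classical
  intro g hg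
  set w := Word.equiv g with hw
  have hwg : w.prod = g := Word.equiv.symm_apply_apply g
  have hfin : ∀ i, {x : G i | (⟨i, x⟩ : Σ i, G i) ∈ w.toList}.Finite := fun i =>
    (List.finite_toSet w.toList).preimage sigma_mk_injective.injOn
  choose Q _ _ ρ hρ using fun i => (hG i).exists_ne_one_of_finite (hfin i)
  have hρw : ∀ l ∈ w.toList, ρ l.1 l.2 ≠ 1 := fun l hl => hρ l.1 l.2 hl (w.ne_one l hl)
  let v := w.mapHom ρ hρw
  have := BoundedWord.finite (Q := Q) v.toList.length
  refine ⟨Equiv.Perm (BoundedWord Q v.toList.length), inferInstance, inferInstance,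
    (truncatedPermHom Q v.toList.length).comp (lift fun i => of.comp (ρ i)), fun h => hg ?_⟩
  rw [MonoidHom.comp_apply, ← hwg, ← Word.prod_mapHom ρ w hρw] at h
  have hv : Word.empty = v := by
    rw [← coe_truncatedPermHom_prod_empty _ v le_rfl, h, Equiv.Perm.one_apply]
  have hnil : w.toList = [] := List.map_eq_nil_iff.1 (congrArg Word.toList hv).symm
  rw [← hwg, Word.prod, hnil, List.map_nil, List.prod_nil]

end ResiduallyFinite

section FiniteNormal

variable {G : ι → Type*} [∀ i, Group (G i)]

theorem NeWord.prod_ne_one {i j : ι} (w : NeWord G i j) : w.prod ≠ 1 := by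
  classical
  intro h
  have h' : w.toWord = Word.empty := Word.equiv.symm.injective (h.trans Word.prod_empty.symm)
  exact w.toList_ne_nil (congrArg Word.toList h')

theorem NeWord.exists_prod_eq_pow {i j : ι} (w : NeWord G i j) (hij : i ≠ j) (n : ℕ) :
    ∃ v : NeWord G i j, v.prod = w.prod ^ (n + 1) := by
  induction n with
  | zero => exact ⟨w, by simp⟩
  | succ n ih =>
    obtain ⟨v, hv⟩ := ih
    exact ⟨v.append hij.symm w, by rw [NeWord.append_prod, hv, ← pow_succ]⟩

theorem NeWord.not_isOfFinOrder_prod {i j : ι} (w : NeWord G i j) (hij : i ≠ j) :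
    ¬ IsOfFinOrder w.prod := by
  rw [isOfFinOrder_iff_pow_eq_one]
  rintro ⟨n, hn, h⟩
  obtain ⟨m, rfl⟩ := Nat.exists_eq_succ_of_ne_zero hn.ne'
  obtain ⟨v, hv⟩ := w.exists_prod_eq_pow hij m
  exact v.prod_ne_one (hv.trans h)

theorem eq_bot_of_normal_of_finite [Nontrivial ι] [∀ i, Nontrivial (G i)]
    (N : Subgroup (CoprodI G)) [N.Normal] [Finite N] : N = ⊥ := by
  classical
  have hfin : ∀ g ∈ N, IsOfFinOrder g := fun g hg =>
    (N.subtype_injective.isOfFinOrder_iff (f := N.subtype)).2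
      (isOfFinOrder_of_finite (⟨g, hg⟩ : N))
  rw [Subgroup.eq_bot_iff_forall]
  intro g hg
  by_contra hg1
  obtain ⟨i, j, w, hw⟩ := NeWord.of_word (Word.equiv g) fun h =>
    hg1 (Word.equiv.injective (h.trans (one_smul (CoprodI G) Word.empty).symm))
  have hwg : w.prod = g := by
    rw [NeWord.prod, hw]
    exact Word.equiv.symm_apply_apply g
  by_cases hij : i = j
  · subst hij
    obtain ⟨k, hk⟩ := exists_ne i
    obtain ⟨c, hc⟩ := exists_ne (1 : G k)
    let v := w.append hk.symm
      (((NeWord.singleton c hc).append hk w).append hk.symm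
        (NeWord.singleton c⁻¹ (inv_ne_one.2 hc)))
    refine v.not_isOfFinOrder_prod hk.symm (hfin _ ?_)
    have hv : v.prod = g * (of c * g * (of c)⁻¹) := by
      simp [v, hwg]
    rw [hv]
    exact N.mul_mem hg (‹N.Normal›.conj_mem g hg (of c))
  · exact w.not_isOfFinOrder_prod hij (hwg ▸ hfin g hg)

end FiniteNormal

end Monoid.CoprodI

section Endomorphism

theorem Group.FG.finite_monoidHom {G Q : Type*} [Group G] [Group Q] [Group.FG G] [Finite Q] :
    Finite (G →* Q) := by
  obtain ⟨S, hS, hfin⟩ := Group.fg_iff.1 ‹Group.FG G›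
  have : Finite S := hfin.to_subtype
  refine Finite.of_injective (fun (f : G →* Q) (s : S) => f s) fun f g h => ?_
  exact MonoidHom.eq_of_eqOn_dense hS fun s hs => congrFun h ⟨s, hs⟩

variable {G : Type*} [Group G]

/-- The iterates of an endomorphism of a group, as homomorphisms. -/
def MonoidHom.iter (φ : G →* G) : ℕ → G →* G
  | 0 => MonoidHom.id G
  | n + 1 => φ.comp (φ.iter n)

theorem MonoidHom.iter_succ' (φ : G →* G) (n : ℕ) : φ.iter (n + 1) = (φ.iter n).comp φ := by
  induction n with
  | zero => rfl
  | succ n ih => exact congrArg φ.comp ih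

theorem MonoidHom.iter_apply_eq_one_of_lt (φ : G →* G) {m n : ℕ} (hmn : m < n) {y : G}
    (hy : φ (φ.iter m y) = 1) : φ.iter n y = 1 := by
  induction n, hmn using Nat.le_induction with
  | base => exact hy
  | succ n _ ih => rw [iter, MonoidHom.comp_apply, ih, map_one]

theorem ResiduallyFinite.eq_one_of_forall_mem_range_iter (hG : ResiduallyFinite G)
    (hfin : ∀ (Q : Type) [Group Q] [Finite Q], Finite (G →* Q)) (φ : G →* G) {x : G}
    (hx : φ x = 1) (hmem : ∀ n : ℕ, x ∈ (φ.iter n).range) : x = 1 := by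
  by_contra hx1
  obtain ⟨Q, _, _, ρ, hρ⟩ := hG x hx1
  have := hfin Q
  choose y hy using hmem
  have key : ∀ m n : ℕ, m < n → ρ.comp (φ.iter m) ≠ ρ.comp (φ.iter n) := by
    intro m n hmn h
    apply hρ
    have h1 : φ.iter n (y m) = 1 := φ.iter_apply_eq_one_of_lt hmn ((congrArg φ (hy m)).trans hx)
    have h2 := DFunLike.congr_fun h (y m)
    rw [MonoidHom.comp_apply, MonoidHom.comp_apply, h1, map_one, hy] at h2
    exact h2
  refine not_injective_infinite_finite (fun n : ℕ => ρ.comp (φ.iter n)) fun m n h => ?_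
  rcases lt_trichotomy m n with hlt | heq | hlt
  · exact absurd h (key m n hlt)
  · exact heq
  · exact absurd h.symm (key n m hlt)

theorem MonoidHom.range_iter_succ (φ : G →* G) (n : ℕ) :
    (φ.iter (n + 1)).range = (φ.iter n).range.map φ :=
  MonoidHom.range_comp _ _

theorem MonoidHom.antitone_range_iter (φ : G →* G) : Antitone fun n => (φ.iter n).range := by
  refine antitone_nat_of_succ_le fun n => ?_
  rw [iter_succ']
  rintro _ ⟨x, rfl⟩
  exact ⟨φ x, rfl⟩

theorem MonoidHom.index_range_iter_ne_zero (φ : G →* G) (h : φ.range.index ≠ 0) (n : ℕ) :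
    (φ.iter n).range.index ≠ 0 := by
  induction n with
  | zero =>
    have : (φ.iter 0).range = ⊤ := MonoidHom.range_eq_top.2 fun x => ⟨x, rfl⟩
    simp [this]
  | succ n ih =>
    rw [range_iter_succ, Subgroup.index_map]
    refine mul_ne_zero (fun h0 => ih ?_) h
    rw [← Subgroup.relIndex_mul_index (le_sup_left (b := φ.ker)), h0, mul_zero]

theorem MonoidHom.relIndex_range_iter_ker_le (φ : G →* G) (h : φ.range.index ≠ 0) (n : ℕ) :
    (φ.iter n).range.relIndex φ.ker ≤ φ.range.index := by
  set R := (φ.iter n).range with hR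
  set K := φ.ker with hK
  have h1 : (φ.iter (n + 1)).range.index = (R ⊔ K).index * φ.range.index := by
    rw [range_iter_succ, Subgroup.index_map]
  have h2 : R.relIndex (R ⊔ K) * (R ⊔ K).index = R.index := Subgroup.relIndex_mul_index le_sup_left
  have h3 : R.index ≤ (φ.iter (n + 1)).range.index :=
    Nat.le_of_dvd (Nat.pos_of_ne_zero (φ.index_range_iter_ne_zero h _))
      (Subgroup.index_dvd_of_le (φ.antitone_range_iter n.le_succ))
  have h4 : (R ⊔ K).index ≠ 0 := fun h0 =>
    φ.index_range_iter_ne_zero h n (by rw [← hR, ← h2, h0, mul_zero])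
  have h5 : R.relIndex (R ⊔ K) ≤ φ.range.index := by
    refine Nat.le_of_mul_le_mul_right ?_ (Nat.pos_of_ne_zero h4)
    rw [h2, mul_comm φ.range.index, ← h1]
    exact h3
  refine le_trans (Subgroup.relIndex_le_of_le_right le_sup_right ?_) h5
  intro h0
  exact φ.index_range_iter_ne_zero h n (by rw [← hR, ← h2, h0, zero_mul])

theorem ResiduallyFinite.finite_ker_of_index_range_ne_zero (hG : ResiduallyFinite G)
    (hfin : ∀ (Q : Type) [Group Q] [Finite Q], Finite (G →* Q)) (φ : G →* G)
    (h : φ.range.index ≠ 0) : Finite φ.ker := by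
  by_contra hinf
  rw [not_finite_iff_infinite] at hinf
  obtain ⟨s, hs⟩ := Infinite.exists_subset_card_eq φ.ker (φ.range.index + 1)
  have hsep : ∀ x : φ.ker, x ≠ 1 → ∃ n : ℕ, (x : G) ∉ (φ.iter n).range := by
    intro x hx
    by_contra! hmem
    exact hx (Subtype.ext (hG.eq_one_of_forall_mem_range_iter hfin φ x.2 hmem))
  choose! f hf using hsep
  let N := s.sup fun a => s.sup fun b => f (a⁻¹ * b)
  have hN : ((φ.iter N).range.subgroupOf φ.ker).index ≠ 0 := by
    intro h0
    exact φ.index_range_iter_ne_zero h N (Subgroup.index_eq_zero_of_relIndex_eq_zero h0)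
  have : ((φ.iter N).range.subgroupOf φ.ker).FiniteIndex := ⟨hN⟩
  let q : s → φ.ker ⧸ ((φ.iter N).range.subgroupOf φ.ker) :=
    fun a => QuotientGroup.mk a.1
  have hq : Function.Injective q := by
    intro a b hab
    by_contra hne
    have hmem := Subgroup.mem_subgroupOf.1 (QuotientGroup.eq.1 hab)
    refine hf (a.1⁻¹ * b.1) (fun h1 => hne (Subtype.ext (inv_mul_eq_one.1 h1))) ?_
    refine φ.antitone_range_iter ?_ hmem
    exact (Finset.le_sup (f := fun b => f (a.1⁻¹ * b)) b.2).trans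
      (Finset.le_sup (f := fun a => s.sup fun b => f (a⁻¹ * b)) a.2)
  have hcard := Nat.card_le_card_of_injective q hq
  have hle := φ.relIndex_range_iter_ker_le h N
  rw [Nat.card_eq_fintype_card, Fintype.card_coe, hs] at hcard
  change _ ≤ (φ.iter N).range.relIndex φ.ker at hcard
  omega

end Endomorphism

section Coprod

theorem Monoid.Coprod.finite_monoidHom {A B Q : Type*} [Group A] [Group B] [Group Q]
    [Finite (A →* Q)] [Finite (B →* Q)] : Finite (A ∗ B →* Q) :=
  Finite.of_injective (fun f : A ∗ B →* Q => (f.comp inl, f.comp inr)) fun _ _ h =>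
    hom_ext (Prod.mk.inj h).1 (Prod.mk.inj h).2

universe u v

/-- Two groups, as a family indexed by `Bool` in a common universe. -/
abbrev BoolFamily (A : Type u) (B : Type v) : Bool → Type (max u v)
  | true => ULift.{v} A
  | false => ULift.{u} B

variable {A : Type u} {B : Type v} [Group A] [Group B]

instance BoolFamily.group : ∀ b, Group (BoolFamily A B b)
  | true => inferInstanceAs (Group (ULift A))
  | false => inferInstanceAs (Group (ULift B))

/-- The binary free product is the free product of a family indexed by `Bool`. -/
def Monoid.Coprod.equivCoprodI : A ∗ B ≃* Monoid.CoprodI (BoolFamily A B) :=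
  MonoidHom.toMulEquiv
    (lift
      ((Monoid.CoprodI.of (M := BoolFamily A B) (i := true)).comp
        (MulEquiv.ulift.symm : A ≃* ULift A).toMonoidHom)
      ((Monoid.CoprodI.of (M := BoolFamily A B) (i := false)).comp
        (MulEquiv.ulift.symm : B ≃* ULift B).toMonoidHom))
    (Monoid.CoprodI.lift fun b => match b with
      | true => inl.comp (MulEquiv.ulift : ULift A ≃* A).toMonoidHom
      | false => inr.comp (MulEquiv.ulift : ULift B ≃* B).toMonoidHom)
    (by apply hom_ext <;> ext x <;> simp)
    (by
      apply Monoid.CoprodI.ext_hom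
      rintro (_ | _) <;> ext x <;> simp)

theorem ResiduallyFinite.coprod (hA : ResiduallyFinite A) (hB : ResiduallyFinite B) :
    ResiduallyFinite (A ∗ B) := by
  have h : ∀ b, ResiduallyFinite (BoolFamily A B b)
    | true => hA.of_injective (MulEquiv.ulift : ULift A ≃* A).toMonoidHom MulEquiv.ulift.injective
    | false => hB.of_injective (MulEquiv.ulift : ULift B ≃* B).toMonoidHom MulEquiv.ulift.injective
  exact (Monoid.CoprodI.residuallyFinite h).of_injective
    (Monoid.Coprod.equivCoprodI (A := A) (B := B)).toMonoidHom (MulEquiv.injective _)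

theorem Monoid.Coprod.eq_bot_of_normal_of_finite [Nontrivial A] [Nontrivial B]
    (N : Subgroup (A ∗ B)) [N.Normal] [Finite N] : N = ⊥ := by
  let e := Monoid.Coprod.equivCoprodI (A := A) (B := B)
  have : ∀ b, Nontrivial (BoolFamily A B b)
    | true => inferInstanceAs (Nontrivial (ULift A))
    | false => inferInstanceAs (Nontrivial (ULift B))
  have hn : (N.map e.toMonoidHom).Normal := Subgroup.Normal.map ‹_› _ e.surjective
  have hf : Finite (N.map e.toMonoidHom) :=
    Finite.of_surjective _ (e.toMonoidHom.subgroupMap_surjective N)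
  exact (Subgroup.map_eq_bot_iff_of_injective N e.injective).1
    (Monoid.CoprodI.eq_bot_of_normal_of_finite (N.map e.toMonoidHom))

end Coprod

/-- If `A` and `B` are nontrivial finitely generated residually finite groups and `φ` is an
endomorphism of the free product `A ∗ B` whose image has finite index, then `φ` is injective. -/
theorem injective_of_finiteIndex_range_coprod {A B : Type*} [Group A] [Group B]
    [Nontrivial A] [Nontrivial B] [Group.FG A] [Group.FG B]
    (hA : ResiduallyFinite A) (hB : ResiduallyFinite B)
    (φ : A ∗ B →* A ∗ B) (hfi : φ.range.FiniteIndex) :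
    Function.Injective φ := by
  have hfin : ∀ (Q : Type) [Group Q] [Finite Q], Finite (A ∗ B →* Q) := fun Q _ _ => by
    have := Group.FG.finite_monoidHom (G := A) (Q := Q)
    have := Group.FG.finite_monoidHom (G := B) (Q := Q)
    exact Monoid.Coprod.finite_monoidHom
  have := (hA.coprod hB).finite_ker_of_index_range_ne_zero hfin φ hfi.index_ne_zero
  exact (MonoidHom.ker_eq_bot_iff φ).1 (Monoid.Coprod.eq_bot_of_normal_of_finite φ.ker)
end

section
/- Let G be a group, N a normal subgroup of G such that N is finitely generated, residually finite, and has trivial center, and suppose the quotient group G/N is residually finite. Then G is residually finite. -/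
/-- There are only finitely many homomorphisms from a finitely generated group to a finite one. -/
theorem MonoidHom.finite_of_group_fg (N Q : Type*) [Group N] [Group.FG N] [Group Q] [Finite Q] :
    Finite (N →* Q) := by
  obtain ⟨S, hS, hfin⟩ := Group.fg_iff.1 (inferInstance : Group.FG N)
  have := hfin.to_subtype
  refine Finite.of_injective (fun (f : N →* Q) (s : S) => f s) fun f f' h => ?_
  exact MonoidHom.eq_of_eqOn_dense hS fun s hs => congrFun h ⟨s, hs⟩

/-- The action of a group on homomorphisms out of a normal subgroup, by precomposition with
conjugation. -/
def Subgroup.conjPermHom {G : Type*} [Group G] (N : Subgroup G) [N.Normal]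
    (Q : Type*) [Group Q] : G →* Equiv.Perm (N →* Q) where
  toFun g :=
    { toFun := fun f => f.comp (MulAut.conjNormal g⁻¹ : MulAut N).toMonoidHom
      invFun := fun f => f.comp (MulAut.conjNormal g : MulAut N).toMonoidHom
      left_inv := fun f => by ext n; simp
      right_inv := fun f => by ext n; simp }
  map_one' := by ext f n; simp
  map_mul' a b := by ext f n; simp

/-- To separate an element from the identity, finite quotients in any universe suffice. -/
theorem exists_finite_type_hom_ne_one {G Q : Type*} [Group G] [Group Q] [Finite Q]
    (ρ : G →* Q) {g : G} (hg : ρ g ≠ 1) :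
    ∃ (Q' : Type) (_ : Group Q') (_ : Finite Q') (ρ' : G →* Q'), ρ' g ≠ 1 := by
  let e : Shrink.{0} Q ≃* Q := Shrink.mulEquiv
  exact ⟨Shrink.{0} Q, inferInstance, Finite.of_equiv Q e.symm.toEquiv,
    e.symm.toMonoidHom.comp ρ, by simpa using hg⟩

/-- Mal'cev–Miller: a group with a finitely generated, residually finite, centerless normal
subgroup whose quotient is residually finite is itself residually finite. -/
theorem residuallyFinite_of_normal_centerless {G : Type*} [Group G]
    (N : Subgroup G) [N.Normal] [Group.FG N]
    (hN : ResiduallyFinite N) (hZ : Subgroup.center N = ⊥)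
    (hQ : ResiduallyFinite (G ⧸ N)) :
    ResiduallyFinite G := by
  intro g hg
  by_cases hgN : g ∈ N
  · have hcenter : (⟨g, hgN⟩ : N) ∉ Subgroup.center N := by
      simpa [hZ, Subgroup.mem_bot, Subtype.ext_iff] using hg
    obtain ⟨n, hn⟩ : ∃ n : N, n * ⟨g, hgN⟩ ≠ ⟨g, hgN⟩ * n := by
      simpa [Subgroup.mem_center_iff] using hcenter
    have hne : MulAut.conjNormal g⁻¹ n * n⁻¹ ≠ 1 := by
      intro h
      apply hn
      have h' := congrArg Subtype.val (mul_inv_eq_one.1 h)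
      simp only [MulAut.conjNormal_apply, inv_inv] at h'
      ext
      simpa [mul_assoc, inv_mul_eq_iff_eq_mul] using h'
    obtain ⟨Q, _, _, ρ, hρ⟩ := hN _ hne
    have := MonoidHom.finite_of_group_fg N Q
    refine exists_finite_type_hom_ne_one (N.conjPermHom Q) (g := g) fun h => hρ ?_
    rw [map_mul, map_inv ρ, mul_inv_eq_one]
    exact DFunLike.congr_fun (Equiv.congr_fun h ρ) n
  · obtain ⟨Q, _, _, ρ, hρ⟩ := hQ (QuotientGroup.mk' N g) (by simpa using hgN)
    exact ⟨Q, _, ‹_›, ρ.comp (QuotientGroup.mk' N), hρ⟩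
end

section
/- Let G be a group and N a normal subgroup of G such that N is finitely generated and residually finite, and suppose the quotient group G/N is a free group. Then G is residually finite. -/
namespace Group

/-- Left multiplication by `x` on a finite subset `S` of a group, where it is defined, extends to
a permutation of `S`. -/
theorem exists_perm_eq_mul_left {G : Type*} [Group G] (S : Set G) [Finite S] (x : G) :
    ∃ σ : Equiv.Perm S, ∀ v w : S, (w : G) = x * v → σ v = w := by
  classical
  have := Fintype.ofFinite S
  let e : {v : S // x * (v : G) ∈ S} ≃ {v : S // x⁻¹ * (v : G) ∈ S} :=
    { toFun := fun v ↦ ⟨⟨x * v.1, v.2⟩, by simp⟩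
      invFun := fun v ↦ ⟨⟨x⁻¹ * v.1, v.2⟩, by simp⟩
      left_inv := fun v ↦ by ext; simp
      right_inv := fun v ↦ by ext; simp }
  refine ⟨e.extendSubtype, fun v w h ↦ ?_⟩
  rw [e.extendSubtype_apply_of_mem v (h ▸ w.2)]
  exact Subtype.ext h.symm

instance residuallyFinite_freeGroup (α : Type*) : Group.ResiduallyFinite (FreeGroup α) := by
  refine residuallyFinite_of_forall_exists_finite_monoidHom fun g hg ↦ ?_
  obtain ⟨L, rfl⟩ := Quot.exists_rep g
  change FreeGroup.mk L ≠ 1 at hg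
  change ∃ (H : Type _) (_ : Group H) (_ : Finite H) (f : FreeGroup α →* H), f (FreeGroup.mk L) ≠ 1
  let S : Set (FreeGroup α) := FreeGroup.mk '' {t | t <:+ L}
  have : Finite S :=
    (((List.finite_toSet L.tails).subset fun t ht ↦ (List.mem_tails t L).2 ht).image _).to_subtype
  choose σ hσ using fun a ↦ exists_perm_eq_mul_left S (FreeGroup.of a)
  have one_mem : (1 : FreeGroup α) ∈ S := ⟨[], List.nil_suffix, rfl⟩
  have key : ∀ t (ht : t <:+ L),
      FreeGroup.lift σ (FreeGroup.mk t) ⟨1, one_mem⟩ = ⟨FreeGroup.mk t, t, ht, rfl⟩ := by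
    intro t
    induction t with
    | nil => intro _; rfl
    | cons x t ih =>
      intro ht
      have ht' : t <:+ L := (List.suffix_cons x t).trans ht
      have hmul : FreeGroup.mk (x :: t) = FreeGroup.mk [x] * FreeGroup.mk t := by
        rw [FreeGroup.mul_mk, List.singleton_append]
      have hlift : FreeGroup.lift σ (FreeGroup.mk (x :: t)) ⟨1, one_mem⟩ =
          FreeGroup.lift σ (FreeGroup.mk [x]) ⟨FreeGroup.mk t, t, ht', rfl⟩ := by
        rw [hmul, map_mul, Equiv.Perm.mul_apply, ih ht']
      rw [hlift]
      obtain ⟨a, b⟩ := x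
      cases b with
      | true => simpa using hσ a _ _ hmul
      | false =>
        have hinv : FreeGroup.mk [(a, false)] = (FreeGroup.of a)⁻¹ := rfl
        rw [hinv, map_inv, FreeGroup.lift_apply_of, Equiv.Perm.inv_eq_iff_eq]
        exact (hσ a _ _ ((mul_inv_cancel_left (FreeGroup.of a) (FreeGroup.mk t)).symm.trans
          (congrArg (FreeGroup.of a * ·) hmul.symm))).symm
  refine ⟨Equiv.Perm S, inferInstance, inferInstance, FreeGroup.lift σ, fun h ↦ hg ?_⟩
  have := key L List.suffix_rfl
  rw [h] at this
  exact (congrArg Subtype.val this).symm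

theorem ResiduallyFinite.of_injective {G H : Type*} [Group G] [Group H]
    [Group.ResiduallyFinite H] (f : G →* H) (hf : Function.Injective f) :
    Group.ResiduallyFinite G := by
  rw [residuallyFinite_iff_forall_finiteIndexNormalSubgroup]
  intro g hg
  exact hf ((eq_one_iff_forall_finiteIndexNormalSubroup (f g) fun K ↦
    hg (K.comap f)).trans (map_one f).symm)

instance residuallyFinite_of_isFreeGroup {G : Type*} [Group G] [IsFreeGroup G] :
    Group.ResiduallyFinite G :=
  .of_injective (IsFreeGroup.toFreeGroup G).toMonoidHom (IsFreeGroup.toFreeGroup G).injective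

theorem finite_monoidHom_of_fg (G Q : Type*) [Group G] [Group.FG G] [Group Q] [Finite Q] :
    Finite (G →* Q) := by
  obtain ⟨S, hS⟩ := Group.fg_def.1 ‹Group.FG G›
  refine Finite.of_injective (fun f : G →* Q ↦ fun s : S ↦ f s) fun f g h ↦ ?_
  exact MonoidHom.eq_of_eqOn_dense hS fun s hs ↦ congrFun h ⟨s, hs⟩

/-- In a finitely generated group, every subgroup of finite index contains a characteristic
subgroup of finite index. -/
theorem exists_characteristic_finiteIndex_le {G : Type*} [Group G] [Group.FG G]
    (H : Subgroup G) [H.FiniteIndex] :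
    ∃ K : Subgroup G, K.Characteristic ∧ K.FiniteIndex ∧ K ≤ H := by
  have := finite_monoidHom_of_fg G (G ⧸ H.normalCore)
  refine ⟨⨅ f : G →* G ⧸ H.normalCore, f.ker, ?_,
    Subgroup.finiteIndex_iInf fun f ↦ Subgroup.finiteIndex_ker f, ?_⟩
  · rw [Subgroup.characteristic_iff_le_comap]
    intro e x hx
    simp only [Subgroup.mem_comap, Subgroup.mem_iInf, MonoidHom.mem_ker] at hx ⊢
    exact fun f ↦ hx (f.comp e.toMonoidHom)
  · refine (iInf_le _ (QuotientGroup.mk' H.normalCore)).trans ?_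
    rw [QuotientGroup.ker_mk']
    exact H.normalCore_le

/-- A split extension of a residually finite group by a finitely generated residually finite group
is residually finite. -/
theorem residuallyFinite_of_splitting {G : Type*} [Group G] (N : Subgroup G) [N.Normal]
    [Group.FG N] [Group.ResiduallyFinite N] [Group.ResiduallyFinite (G ⧸ N)]
    (s : G ⧸ N →* G) (hs : ∀ q, (s q : G ⧸ N) = q) : Group.ResiduallyFinite G := by
  rw [residuallyFinite_iff_exists_finiteIndex]
  intro g hg
  by_cases hgN : g ∈ N
  · obtain ⟨H, hgH⟩ := exists_finiteIndexNormalSubgroup_notMem (⟨g, hgN⟩ : N)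
      fun h ↦ hg (congrArg Subtype.val h)
    obtain ⟨K, hK, hKfin, hKH⟩ := exists_characteristic_finiteIndex_le H.toSubgroup
    refine ⟨K.map N.subtype ⊔ s.range, ?_, fun h ↦ ?_⟩
    · rw [Subgroup.finiteIndex_iff_finite_quotient]
      let φ : N ⧸ K → G ⧸ (K.map N.subtype ⊔ s.range) :=
        Quotient.map' N.subtype fun a b hab ↦ by
          rw [QuotientGroup.leftRel_apply] at hab ⊢
          exact Subgroup.mem_sup_left ⟨_, hab, by simp⟩
      refine Finite.of_surjective φ fun x ↦ ?_
      obtain ⟨x, rfl⟩ := QuotientGroup.mk_surjective x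
      have hx : x * (s x)⁻¹ ∈ N := by
        rw [← QuotientGroup.eq_one_iff, QuotientGroup.mk_mul, QuotientGroup.mk_inv, hs,
          mul_inv_cancel]
      refine ⟨QuotientGroup.mk ⟨_, hx⟩, ?_⟩
      change QuotientGroup.mk (x * (s x)⁻¹) = QuotientGroup.mk x
      rw [QuotientGroup.eq]
      exact Subgroup.mem_sup_right ⟨x, by simp⟩
    · obtain ⟨_, ⟨k, hk, rfl⟩, _, ⟨q, rfl⟩, hkq⟩ := Subgroup.mem_sup_of_normal_left.1 h
      have hq : q = 1 := by
        rw [← hs q, QuotientGroup.eq_one_iff]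
        rw [← hkq] at hgN
        exact (N.mul_mem_cancel_left k.2).1 hgN
      subst hq
      rw [map_one, mul_one] at hkq
      exact hgH (hKH ((Subtype.ext hkq : k = ⟨g, hgN⟩) ▸ hk))
  · obtain ⟨H, hH⟩ := exists_finiteIndexNormalSubgroup_notMem (g : G ⧸ N)
      fun h ↦ hgN ((QuotientGroup.eq_one_iff g).1 h)
    exact ⟨(H.comap (QuotientGroup.mk' N)).toSubgroup, inferInstance, hH⟩

end Group

theorem residuallyFinite_iff_group_residuallyFinite {G : Type*} [Group G] :
    ResiduallyFinite G ↔ Group.ResiduallyFinite G := by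
  refine ⟨Group.residuallyFinite_of_forall_exists_finite_monoidHom, fun _ g hg ↦ ?_⟩
  obtain ⟨H, hH⟩ := Group.exists_finiteIndexNormalSubgroup_notMem g hg
  let e := Shrink.mulEquiv.{0} (α := G ⧸ H.toSubgroup)
  refine ⟨Shrink.{0} (G ⧸ H.toSubgroup), inferInstance, inferInstance,
    e.symm.toMonoidHom.comp (QuotientGroup.mk' H.toSubgroup), fun h ↦ hH ?_⟩
  exact (QuotientGroup.eq_one_iff g).1 (e.symm.map_eq_one_iff.1 h)

/-- A group with a finitely generated residually finite normal subgroup whose quotient is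
a free group is residually finite. -/
theorem residuallyFinite_of_free_quotient {G : Type*} [Group G]
    (N : Subgroup G) [N.Normal] [Group.FG N]
    (hN : ResiduallyFinite N) (hQ : IsFreeGroup (G ⧸ N)) :
    ResiduallyFinite G := by
  rw [residuallyFinite_iff_group_residuallyFinite] at hN ⊢
  let s : G ⧸ N →* G := IsFreeGroup.lift fun a ↦ (IsFreeGroup.of a).out
  have hs : (QuotientGroup.mk' N).comp s = MonoidHom.id _ :=
    IsFreeGroup.ext_hom fun a ↦ by simp [s]
  exact Group.residuallyFinite_of_splitting N s (DFunLike.congr_fun hs)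
end

section
/- The free product of two residually finite groups is residually finite: if A and B are residually finite groups, then A ∗ B is residually finite. -/
open Monoid.Coprod

/-- A residually finite group has a finite quotient in which no element of a given finite list of
nontrivial elements dies. -/
theorem ResiduallyFinite.exists_forall_mem_ne_one {G : Type*} [Group G] (hG : ResiduallyFinite G)
    (l : List G) :
    ∃ (Q : Type) (_ : Group Q) (_ : Finite Q) (ρ : G →* Q), ∀ g ∈ l, g ≠ 1 → ρ g ≠ 1 := by
  induction l with
  | nil => exact ⟨Unit, inferInstance, inferInstance, 1, by simp⟩
  | cons g l ih =>
    obtain ⟨Q, _, _, ρ, hρ⟩ := ih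
    by_cases hg : g = 1
    · refine ⟨Q, inferInstance, inferInstance, ρ, fun x hx hx1 => ?_⟩
      rcases List.mem_cons.1 hx with rfl | hx
      · exact absurd hg hx1
      · exact hρ x hx hx1
    · obtain ⟨R, _, _, σ, hσ⟩ := hG g hg
      refine ⟨R × Q, inferInstance, inferInstance, σ.prod ρ, fun x hx hx1 h => ?_⟩
      rw [MonoidHom.prod_apply, Prod.mk_eq_one] at h
      rcases List.mem_cons.1 hx with rfl | hx
      · exact hσ h.1
      · exact hρ x hx hx1 h.2

/-- Every element of a free product is the product of a word with nontrivial letters coming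
alternately from the two factors. -/
theorem Monoid.Coprod.exists_reduced_word {A B : Type*} [Group A] [Group B] (g : A ∗ B) :
    ∃ l : List (A ⊕ B), (l.map (Sum.elim inl inr)).prod = g ∧
      (∀ x ∈ l, x ≠ Sum.inl 1 ∧ x ≠ Sum.inr 1) ∧
      l.IsChain fun x y => x.isLeft ≠ y.isLeft := by
  induction g using Monoid.Coprod.induction_on' with
  | one => exact ⟨[], by simp⟩
  | inl_mul a g ih =>
    obtain ⟨l, rfl, hl, hc⟩ := ih
    by_cases ha : a = 1
    · exact ⟨l, by simp [ha], hl, hc⟩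
    match l with
    | [] => exact ⟨[Sum.inl a], by simp [ha]⟩
    | Sum.inr b :: l => exact ⟨Sum.inl a :: Sum.inr b :: l, by simp, by simp_all, by simp_all⟩
    | Sum.inl a' :: l =>
      by_cases h : a * a' = 1
      · refine ⟨l, ?_, fun x hx => hl x (List.mem_cons_of_mem _ hx), hc.tail⟩
        simp [← mul_assoc, ← map_mul, h]
      · refine ⟨Sum.inl (a * a') :: l, by simp [mul_assoc], by simp_all, ?_⟩
        cases l <;> simp_all
  | inr_mul b g ih =>
    obtain ⟨l, rfl, hl, hc⟩ := ih
    by_cases hb : b = 1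
    · exact ⟨l, by simp [hb], hl, hc⟩
    match l with
    | [] => exact ⟨[Sum.inr b], by simp [hb]⟩
    | Sum.inl a :: l => exact ⟨Sum.inr b :: Sum.inl a :: l, by simp, by simp_all, by simp_all⟩
    | Sum.inr b' :: l =>
      by_cases h : b * b' = 1
      · refine ⟨l, ?_, fun x hx => hl x (List.mem_cons_of_mem _ hx), hc.tail⟩
        simp [← mul_assoc, ← map_mul, h]
      · refine ⟨Sum.inr (b * b') :: l, by simp [mul_assoc], by simp_all, ?_⟩
        cases l <;> simp_all

/-- In the action of `Q` on `Fin (n + 1) × Q` by left multiplication on the second factor, there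
is an injective path of length `n` whose edges with nontrivial labels `a i` are realized by the
action, provided that no two consecutive labels are nontrivial. -/
theorem exists_injOn_path {Q : Type*} [Group Q] (n : ℕ) (a : ℕ → Q)
    (ha : ∀ i, a i = 1 ∨ a (i + 1) = 1) :
    ∃ u : ℕ → Fin (n + 1) × Q, Set.InjOn u (Set.Iic n) ∧
      ∀ i < n, a i ≠ 1 → a i • (u (i + 1)).2 = (u i).2 ∧ (u (i + 1)).1 = (u i).1 := by
  classical
  let c : ℕ → Q := fun j => Nat.casesOn (motive := fun _ => Q) j 1 a
  have hc : ∀ i, c i = 1 ∨ c (i + 1) = 1 := by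
    rintro (_ | i)
    · exact Or.inl rfl
    · exact ha i
  let u : ℕ → Fin (n + 1) × Q := fun j =>
    if c j = 1 then (Fin.ofNat (n + 1) j, 1) else (Fin.ofNat (n + 1) (j - 1), (c j)⁻¹)
  refine ⟨u, ?_, ?_⟩
  · have key : ∀ i ≤ n, ∀ j ≤ n, (Fin.ofNat (n + 1) i = Fin.ofNat (n + 1) j) → i = j := by
      intro i hi j hj h
      simpa [Fin.ext_iff, Fin.ofNat, Nat.mod_eq_of_lt (Nat.lt_succ_of_le hi),
        Nat.mod_eq_of_lt (Nat.lt_succ_of_le hj)] using h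
    have hc0 : ∀ i, c i ≠ 1 → i ≠ 0 := by
      rintro i hi rfl
      exact hi rfl
    intro i hi j hj h
    simp only [Set.mem_Iic] at hi hj
    simp only [u] at h
    split_ifs at h with h1 h2 h2 <;> simp only [Prod.mk.injEq] at h
    · exact key _ hi _ hj h.1
    · exact absurd (inv_eq_one.1 h.2.symm) h2
    · exact absurd (inv_eq_one.1 h.2) h1
    · have := key _ (by omega) _ (by omega) h.1
      have := hc0 i h1
      have := hc0 j h2
      omega
  · intro i _ hi
    have h : c (i + 1) ≠ 1 := hi
    have h' : c i = 1 := (hc i).resolve_right h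
    simp only [u]
    rw [if_neg h, if_pos h']
    exact ⟨mul_inv_cancel (a i), rfl⟩

/-- A word acts on the end of a path labelled by its letters by moving it to the start. -/
theorem List.prod_apply_path {X : Type*} (l : List (Equiv.Perm X)) (u : ℕ → X)
    (h : ∀ (i : ℕ) (hi : i < l.length), l[i] (u (i + 1)) = u i) :
    l.prod (u l.length) = u 0 := by
  induction l generalizing u with
  | nil => rfl
  | cons x l ih =>
    rw [List.prod_cons, Equiv.Perm.mul_apply, List.length_cons,
      ih (fun i => u (i + 1)) fun i hi => h (i + 1) (Nat.succ_lt_succ hi)]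
    exact h 0 (Nat.succ_pos _)

/-- Gruenberg: the free product of two residually finite groups is residually finite. -/
theorem residuallyFinite_coprod {A B : Type*} [Group A] [Group B]
    (hA : ResiduallyFinite A) (hB : ResiduallyFinite B) :
    ResiduallyFinite (A ∗ B) := by
  intro g hg
  obtain ⟨l, rfl, hl, hc⟩ := Monoid.Coprod.exists_reduced_word g
  obtain ⟨P, _, _, α, hα⟩ := hA.exists_forall_mem_ne_one (l.filterMap Sum.getLeft?)
  obtain ⟨R, _, _, β, hβ⟩ := hB.exists_forall_mem_ne_one (l.filterMap Sum.getRight?)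
  let Q := P × R
  let α' : A →* Q := (MonoidHom.inl P R).comp α
  let β' : B →* Q := (MonoidHom.inr P R).comp β
  let a : ℕ → Q := fun i => (l.map (Sum.elim α' 1)).getD i 1
  let b : ℕ → Q := fun i => (l.map (Sum.elim 1 β')).getD i 1
  have hlabel (f : A ⊕ B → Q) (hf : ∀ x y, x.isLeft ≠ y.isLeft → f x = 1 ∨ f y = 1) (i : ℕ) :
      (l.map f).getD i 1 = 1 ∨ (l.map f).getD (i + 1) 1 = 1 := by
    by_cases hi : i + 1 < l.length
    · simpa [List.getElem?_eq_getElem hi, List.getElem?_eq_getElem (Nat.lt_of_succ_lt hi)]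
        using hf _ _ (List.isChain_iff_getElem.1 hc i hi)
    · right
      simp [List.getElem?_eq_none (not_lt.1 hi)]
  have ha : ∀ i, a i = 1 ∨ a (i + 1) = 1 := hlabel _ (by rintro (x | x) (y | y) <;> simp)
  have hb : ∀ i, b i = 1 ∨ b (i + 1) = 1 := hlabel _ (by rintro (x | x) (y | y) <;> simp)
  obtain ⟨u, hu, hua⟩ := exists_injOn_path l.length a ha
  obtain ⟨v, hv, hvb⟩ := exists_injOn_path l.length b hb
  obtain ⟨σ, hσ⟩ := Equiv.Perm.exists_extending_pair _ _ hu.injective hv.injective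
  replace hσ : ∀ i ≤ l.length, σ (u i) = v i := fun i hi => hσ ⟨i, hi⟩
  let X := Fin (l.length + 1) × Q
  let φ : Q →* Equiv.Perm X :=
    { toFun := fun q => (Equiv.refl _).prodCongr (MulAction.toPerm q)
      map_one' := by ext x <;> simp
      map_mul' := fun p q => by ext x <;> simp [mul_assoc] }
  let ρ : A ∗ B →* Equiv.Perm X :=
    lift (φ.comp α') ((MulAut.conj σ⁻¹).toMonoidHom.comp (φ.comp β'))
  refine ⟨Equiv.Perm X, inferInstance, inferInstance, ρ, fun h => ?_⟩
  have hend : ρ (l.map (Sum.elim inl inr)).prod (u l.length) = u 0 := by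
    rw [map_list_prod, List.map_map]
    rw [← List.length_map (as := l) (ρ ∘ Sum.elim inl inr)]
    refine List.prod_apply_path _ u fun i hi => ?_
    rw [List.length_map] at hi
    have hmem := List.getElem_mem hi
    rw [List.getElem_map]
    rcases hx : l[i] with x | x
    · have hai : a i = α' x := by simp [a, List.getElem?_eq_getElem hi, hx]
      have hne : a i ≠ 1 := by
        have hx1 : α x ≠ 1 := hα x
          (List.mem_filterMap.2 ⟨_, hmem, by simp [hx]⟩) fun h1 => (hl _ hmem).1 (by rw [hx, h1])
        simpa [hai, α', Q] using hx1
      have := hua i hi hne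
      rw [hai] at this
      exact Prod.ext this.2 this.1
    · have hbi : b i = β' x := by simp [b, List.getElem?_eq_getElem hi, hx]
      have hne : b i ≠ 1 := by
        have hx1 : β x ≠ 1 := hβ x
          (List.mem_filterMap.2 ⟨_, hmem, by simp [hx]⟩) fun h1 => (hl _ hmem).2 (by rw [hx, h1])
        simpa [hbi, β', Q] using hx1
      have := hvb i hi hne
      rw [hbi] at this
      have hstep : φ (β' x) (v (i + 1)) = v i := Prod.ext this.2 this.1
      change (σ⁻¹ * φ (β' x) * (σ⁻¹)⁻¹) (u (i + 1)) = u i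
      rw [inv_inv, Equiv.Perm.mul_apply, Equiv.Perm.mul_apply, hσ _ hi, hstep, ← hσ _ hi.le]
      exact σ.symm_apply_apply _
  rw [h, Equiv.Perm.one_apply] at hend
  have hlen : l.length = 0 := hu (Set.mem_Iic.2 le_rfl) (Set.mem_Iic.2 (Nat.zero_le _)) hend
  rw [List.length_eq_zero_iff] at hlen
  exact hg (by simp [hlen])
end

section
/- A nontrivial free product contains no nontrivial finite normal subgroup: if A and B are nontrivial groups and N is a finite normal subgroup of the free product A ∗ B, then N is the trivial subgroup. -/
open Monoid.Coprod

namespace Monoid.CoprodI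

open scoped Classical in
/-- The number of letters in the reduced word representing an element of a free product. -/
noncomputable def wordLength {ι : Type*} {G : ι → Type*} [∀ i, Group (G i)]
    (g : CoprodI G) : ℕ :=
  (Word.equiv g).toList.length

theorem wordLength_prod {ι : Type*} {G : ι → Type*} [∀ i, Group (G i)] {i j : ι}
    (w : NeWord G i j) : wordLength w.prod = w.toList.length := by
  classical
  have h : Word.equiv (Word.prod w.toWord) = w.toWord := Word.equiv.apply_symm_apply _
  rw [wordLength, NeWord.prod]
  exact congrArg (fun v : Word G => v.toList.length) h

theorem exists_neWord_prod_eq {ι : Type*} {G : ι → Type*} [∀ i, Group (G i)] {g : CoprodI G}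
    (hg : g ≠ 1) : ∃ (i j : ι) (w : NeWord G i j), w.prod = g := by
  classical
  have hp : (Word.equiv g).prod = g := Word.equiv.symm_apply_apply g
  obtain ⟨i, j, w, hw⟩ := NeWord.of_word (Word.equiv g) fun h => hg (by
    rw [← hp, h, Word.prod_empty])
  exact ⟨i, j, w, by rw [NeWord.prod, hw, hp]⟩

/-- A nontrivial element of a normal subgroup of a nontrivial free product is never of maximal
word length in that subgroup. -/
theorem exists_mem_wordLength_lt {ι : Type*} [Nontrivial ι] {G : ι → Type*} [∀ i, Group (G i)]
    [∀ i, Nontrivial (G i)] (N : Subgroup (CoprodI G)) [hN : N.Normal] {g : CoprodI G}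
    (hgN : g ∈ N) (hg : g ≠ 1) : ∃ h ∈ N, h ≠ 1 ∧ wordLength g < wordLength h := by
  obtain ⟨i, j, w, rfl⟩ := exists_neWord_prod_eq hg
  suffices H : ∃ h ∈ N, wordLength w.prod < wordLength h by
    obtain ⟨h, hhN, hlt⟩ := H
    refine ⟨h, hhN, ?_, hlt⟩
    rintro rfl
    simp [wordLength, Word.equiv] at hlt
  by_cases hij : i = j
  · subst hij
    obtain ⟨k, hk⟩ := exists_ne i
    obtain ⟨x, hx⟩ := exists_ne (1 : G k)
    let v : NeWord G k k := .append (.append (.singleton x hx) hk w) hk.symm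
      (.singleton x⁻¹ (inv_ne_one.mpr hx))
    refine ⟨v.prod, ?_, ?_⟩
    · simpa [v] using hN.conj_mem _ hgN (of x)
    · simp only [wordLength_prod, v, NeWord.toList, List.length_append, List.length_singleton]
      omega
  · refine ⟨(NeWord.append w (Ne.symm hij) w).prod, ?_, ?_⟩
    · simpa using N.mul_mem hgN hgN
    · have := List.length_pos_iff.mpr w.toList_ne_nil
      simp only [wordLength_prod, NeWord.toList, List.length_append]
      omega

theorem finite_normal_subgroup_eq_bot {ι : Type*} [Nontrivial ι] {G : ι → Type*}
    [∀ i, Group (G i)] [∀ i, Nontrivial (G i)] (N : Subgroup (CoprodI G)) [N.Normal]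
    [Finite N] : N = ⊥ := by
  by_contra hne
  obtain ⟨g, hgN, hg⟩ := N.bot_or_exists_ne_one.resolve_left hne
  have hfin : {h : CoprodI G | h ∈ N ∧ h ≠ 1}.Finite :=
    (Set.toFinite (N : Set (CoprodI G))).subset fun _ h => h.1
  obtain ⟨m, ⟨hmN, hm⟩, hmax⟩ := hfin.exists_maximalFor wordLength _ ⟨g, hgN, hg⟩
  obtain ⟨h, hhN, hh, hlt⟩ := exists_mem_wordLength_lt N hmN hm
  exact hlt.not_ge (hmax ⟨hhN, hh⟩ hlt.le)

end Monoid.CoprodI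

namespace Monoid.Coprod

universe u v

/-- The two factors of a binary free product, lifted to a common universe. -/
def Factor (A : Type u) (B : Type v) : Bool → Type (max u v)
  | true => ULift.{v} A
  | false => ULift.{u} B

variable (A : Type u) (B : Type v)

instance [Group A] [Group B] : ∀ b, Group (Factor A B b)
  | true => inferInstanceAs (Group (ULift A))
  | false => inferInstanceAs (Group (ULift B))

instance [Nontrivial A] [Nontrivial B] : ∀ b, Nontrivial (Factor A B b)
  | true => inferInstanceAs (Nontrivial (ULift A))
  | false => inferInstanceAs (Nontrivial (ULift B))

variable [Group A] [Group B]

/-- The inclusion of a factor into the binary free product. -/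
def ofFactor : ∀ b, Factor A B b →* A ∗ B
  | true => (inl : A →* A ∗ B).comp (MulEquiv.ulift : ULift.{v} A ≃* A).toMonoidHom
  | false => (inr : B →* A ∗ B).comp (MulEquiv.ulift : ULift.{u} B ≃* B).toMonoidHom

/-- The binary free product as an indexed free product. -/
def mulEquivCoprodI : A ∗ B ≃* CoprodI (Factor A B) :=
  MonoidHom.toMulEquiv
    (lift
      ((CoprodI.of (M := Factor A B) (i := true)).comp
        (MulEquiv.ulift : ULift.{v} A ≃* A).symm.toMonoidHom)
      ((CoprodI.of (M := Factor A B) (i := false)).comp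
        (MulEquiv.ulift : ULift.{u} B ≃* B).symm.toMonoidHom))
    (CoprodI.lift (ofFactor A B))
    (by
      ext x
      · exact CoprodI.lift_of (ofFactor A B) (i := true) (ULift.up x)
      · exact CoprodI.lift_of (ofFactor A B) (i := false) (ULift.up x))
    (by
      refine CoprodI.ext_hom _ _ fun b => MonoidHom.ext fun x => ?_
      rw [MonoidHom.comp_apply, MonoidHom.comp_apply, CoprodI.lift_of]
      cases b <;> rfl)

end Monoid.Coprod

/-- A nontrivial free product contains no nontrivial finite normal subgroup. -/
theorem finite_normal_subgroup_of_coprod_eq_bot {A B : Type*} [Group A] [Group B]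
    [Nontrivial A] [Nontrivial B]
    (N : Subgroup (A ∗ B)) [N.Normal] (hfin : Finite N) :
    N = ⊥ := by
  let e := mulEquivCoprodI A B
  have : (N.map e.toMonoidHom).Normal := Subgroup.Normal.map ‹_› _ e.surjective
  have : Finite (N.map e.toMonoidHom) :=
    Finite.of_equiv N (N.equivMapOfInjective e.toMonoidHom e.injective).toEquiv
  exact (N.map_eq_bot_iff_of_injective e.injective).mp
    (Monoid.CoprodI.finite_normal_subgroup_eq_bot (N.map e.toMonoidHom))
end

section
/- Every finitely generated residually finite group is Hopfian: if G is finitely generated and residually finite, then every surjective group endomorphism φ : G → G is injective, hence an automorphism. -/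
/-- Mal'cev: every finitely generated residually finite group is Hopfian: every surjective
endomorphism is injective, hence an automorphism. -/
theorem hopfian_of_residuallyFinite {G : Type*} [Group G] [Group.FG G]
    (hRF : ResiduallyFinite G) (φ : G →* G) (hsurj : Function.Surjective φ) :
    Function.Injective φ := by
  refine (injective_iff_map_eq_one φ).mpr fun g hg ↦ ?_
  by_contra hne
  obtain ⟨Q, _, _, ρ, hρ⟩ := hRF g hne
  have := MonoidHom.finite_of_fg G Q
  have hinj : Function.Injective fun ψ : G →* Q ↦ ψ.comp φ :=
    fun _ _ h ↦ (MonoidHom.cancel_right hsurj).mp h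
  obtain ⟨ψ, rfl⟩ := Finite.surjective_of_injective hinj ρ
  exact hρ (by simp [hg])
end
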